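/- arXiv:1701.06084 — 5 statements merged into one kernel-verified Lean document; each statement's English description precedes it below -/
import Mathlib

section
/- For any two probability mass functions p1, p2 with full support on a finite alphabet Y, twice the Bhattacharyya distance equals the minimum over all pmfs q on Y of the sum of KL divergences to p1 and p2: 2·B(p1,p2) = min_{q ∈ P(Y)} ( D(q‖p1) + D(q‖p2) ). -/
open scoped BigOperators

/-- A probability mass function on a finite alphabet `Y`. -/
def IsPmf {Y : Type*} [Fintype Y] (p : Y → ℝ) : Prop :=
  (∀ y, 0 ≤ p y) ∧ ∑ y, p y = 1

/-- KL divergence `D(p‖q)`, valued in the extended reals: it is `+∞` when the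
support of `p` is not contained in that of `q`. -/
noncomputable def KL {Y : Type*} [Fintype Y] (p q : Y → ℝ) : EReal :=
  if ∀ y, q y = 0 → p y = 0 then ((∑ y, p y * Real.log (p y / q y) : ℝ) : EReal) else ⊤

/-- Bhattacharyya distance `B(p,q) = −log( Σ_y √(p y) √(q y) )`. -/
noncomputable def Bhat {Y : Type*} [Fintype Y] (p q : Y → ℝ) : ℝ :=
  - Real.log (∑ y, Real.sqrt (p y) * Real.sqrt (q y))

lemma KL_eq_sum_of_pos {Y : Type*} [Fintype Y] (q p : Y → ℝ) (hp : ∀ y, 0 < p y) :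
    KL q p = ((∑ y, q y * Real.log (q y / p y) : ℝ) : EReal) :=
  if_pos fun y hy => absurd hy (hp y).ne'

lemma mul_log_div_add_mul_log_div {q a b : ℝ} (hq : 0 ≤ q) (ha : 0 < a) (hb : 0 < b) :
    q * Real.log (q / a) + q * Real.log (q / b) =
      2 * (q * Real.log (q / (Real.sqrt a * Real.sqrt b))) := by
  rcases hq.eq_or_lt with rfl | hq
  · simp
  have ha' := Real.sqrt_pos.2 ha
  have hb' := Real.sqrt_pos.2 hb
  rw [Real.log_div hq.ne' ha.ne', Real.log_div hq.ne' hb.ne',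
    Real.log_div hq.ne' (mul_pos ha' hb').ne', Real.log_mul ha'.ne' hb'.ne',
    Real.log_sqrt ha.le, Real.log_sqrt hb.le]
  ring

lemma KL_add_KL {Y : Type*} [Fintype Y] {q p1 p2 : Y → ℝ} (hq : ∀ y, 0 ≤ q y)
    (h1 : ∀ y, 0 < p1 y) (h2 : ∀ y, 0 < p2 y) :
    KL q p1 + KL q p2 =
      ((2 * ∑ y, q y * Real.log (q y / (Real.sqrt (p1 y) * Real.sqrt (p2 y))) : ℝ) : EReal) := by
  rw [KL_eq_sum_of_pos q p1 h1, KL_eq_sum_of_pos q p2 h2, ← EReal.coe_add,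
    ← Finset.sum_add_distrib, Finset.mul_sum]
  exact congrArg _ (Finset.sum_congr rfl fun y _ =>
    mul_log_div_add_mul_log_div (hq y) (h1 y) (h2 y))

/-- A tangent-line bound for `q ↦ q * log (q / s)`. -/
lemma sub_div_sub_mul_log_le {q s S : ℝ} (hq : 0 ≤ q) (hs : 0 < s) (hS : 0 < S) :
    q - s / S - q * Real.log S ≤ q * Real.log (q / s) := by
  rcases hq.eq_or_lt with rfl | hq
  · simpa using (div_pos hs hS).le
  have h := mul_le_mul_of_nonneg_left
    (Real.one_sub_inv_le_log_of_pos (show 0 < q / s * S by positivity)) hq.le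
  rw [Real.log_mul (div_pos hq hs).ne' hS.ne'] at h
  have e : q * (1 - (q / s * S)⁻¹) = q - s / S := by field_simp
  linarith

/-- For pmfs `p1, p2` with full support, twice the Bhattacharyya
distance is the minimum of `q ↦ D(q‖p1) + D(q‖p2)` over all pmfs `q`. -/
theorem twoBhat_eq_min_KL_sum {Y : Type*} [Fintype Y] [Nonempty Y] (p1 p2 : Y → ℝ)
    (h1 : IsPmf p1) (h2 : IsPmf p2) (h1f : ∀ y, 0 < p1 y) (h2f : ∀ y, 0 < p2 y) :
    IsLeast {r : EReal | ∃ q : Y → ℝ, IsPmf q ∧ r = KL q p1 + KL q p2}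
      (((2 * Bhat p1 p2 : ℝ) : EReal)) := by
  have hs : ∀ y, 0 < Real.sqrt (p1 y) * Real.sqrt (p2 y) := fun y =>
    mul_pos (Real.sqrt_pos.2 (h1f y)) (Real.sqrt_pos.2 (h2f y))
  have hS : 0 < ∑ y, Real.sqrt (p1 y) * Real.sqrt (p2 y) :=
    Finset.sum_pos (fun y _ => hs y) Finset.univ_nonempty
  unfold Bhat
  set S := ∑ y, Real.sqrt (p1 y) * Real.sqrt (p2 y) with hSdef
  constructor
  · have hq : ∀ y, 0 ≤ Real.sqrt (p1 y) * Real.sqrt (p2 y) / S := fun y =>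
      (div_pos (hs y) hS).le
    have hsum : ∑ y, Real.sqrt (p1 y) * Real.sqrt (p2 y) / S = 1 := by
      rw [← Finset.sum_div, ← hSdef, div_self hS.ne']
    refine ⟨fun y => Real.sqrt (p1 y) * Real.sqrt (p2 y) / S, ⟨hq, hsum⟩, ?_⟩
    rw [KL_add_KL hq h1f h2f]
    have hlog : ∀ y, Real.log (Real.sqrt (p1 y) * Real.sqrt (p2 y) / S /
        (Real.sqrt (p1 y) * Real.sqrt (p2 y))) = -Real.log S := fun y => by
      rw [div_right_comm, div_self (hs y).ne', one_div, Real.log_inv]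
    simp only [hlog]
    rw [← Finset.sum_mul, hsum, one_mul]
  · rintro r ⟨q, ⟨hq, hsum⟩, rfl⟩
    rw [KL_add_KL hq h1f h2f, EReal.coe_le_coe_iff]
    have h := Finset.sum_le_sum fun y (_ : y ∈ Finset.univ) =>
      sub_div_sub_mul_log_le (hq y) (hs y) hS
    rw [Finset.sum_sub_distrib, Finset.sum_sub_distrib, ← Finset.sum_mul, hsum,
      ← Finset.sum_div, ← hSdef, div_self hS.ne'] at h
    linarith
end

section
/- (Positivity of the exponent α1) Let Y be a finite alphabet, let S be a nonempty finite index set, and let π and μ_i (i ∈ S) be pmfs on Y with full support such that μ_i ≠ π for every i ∈ S. Then the infimum, over i ∈ S and over triples of pmfs (q1, q2, q3) on Y satisfying D(q1‖q2) ≤ D(q3‖q2), of D(q1‖μ_i) + D(q2‖π) + D(q3‖π), is strictly positive. -/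
open scoped BigOperators

/-- The squared Hellinger distance `Σ_y (√(p y) − √(q y))²`. -/
noncomputable def hellingerSq {Y : Type*} [Fintype Y] (p q : Y → ℝ) : ℝ :=
  ∑ y, (√(p y) - √(q y)) ^ 2

section

variable {Y : Type*} [Fintype Y] {p q : Y → ℝ}

lemma IsPmf.le_one (hp : IsPmf p) (y : Y) : p y ≤ 1 :=
  hp.2 ▸ Finset.single_le_sum (fun z _ => hp.1 z) (Finset.mem_univ y)

lemma hellingerSq_nonneg (p q : Y → ℝ) : 0 ≤ hellingerSq p q :=
  Finset.sum_nonneg fun _ _ => sq_nonneg _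

lemma hellingerSq_comm (p q : Y → ℝ) : hellingerSq p q = hellingerSq q p :=
  Finset.sum_congr rfl fun _ _ => by ring

lemma hellingerSq_triangle (p q r : Y → ℝ) :
    hellingerSq p r ≤ 2 * hellingerSq p q + 2 * hellingerSq q r := by
  unfold hellingerSq
  rw [Finset.mul_sum, Finset.mul_sum, ← Finset.sum_add_distrib]
  gcongr with y
  nlinarith [sq_nonneg ((√(p y) - √(q y)) - (√(q y) - √(r y)))]

lemma sq_sqrt_sub_sqrt_le_hellingerSq (p q : Y → ℝ) (y : Y) :
    (√(p y) - √(q y)) ^ 2 ≤ hellingerSq p q :=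
  Finset.single_le_sum (f := fun y => (√(p y) - √(q y)) ^ 2)
    (fun _ _ => sq_nonneg _) (Finset.mem_univ y)

lemma hellingerSq_pos (hp : ∀ y, 0 ≤ p y) (hq : ∀ y, 0 ≤ q y) (h : p ≠ q) :
    0 < hellingerSq p q := by
  obtain ⟨y, hy⟩ := Function.ne_iff.1 h
  have hs : √(p y) - √(q y) ≠ 0 := fun h0 =>
    hy ((Real.sqrt_inj (hp y) (hq y)).1 (sub_eq_zero.1 h0))
  exact (by positivity : 0 < (√(p y) - √(q y)) ^ 2).trans_le
    (sq_sqrt_sub_sqrt_le_hellingerSq p q y)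

lemma sq_sqrt_sub_sqrt_add_sub_le_mul_log {a b : ℝ} (ha : 0 ≤ a) (hb : 0 ≤ b)
    (hab : b = 0 → a = 0) : (√a - √b) ^ 2 + (a - b) ≤ a * Real.log (a / b) := by
  rcases ha.eq_or_lt with rfl | ha
  · simp [Real.sq_sqrt hb]
  have hb : 0 < b := hb.lt_of_ne fun h => ha.ne' (hab h.symm)
  obtain ⟨x, hx, rfl⟩ : ∃ x, 0 < x ∧ a = x ^ 2 :=
    ⟨√a, Real.sqrt_pos.2 ha, (Real.sq_sqrt ha.le).symm⟩
  obtain ⟨z, hz, rfl⟩ : ∃ z, 0 < z ∧ b = z ^ 2 :=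
    ⟨√b, Real.sqrt_pos.2 hb, (Real.sq_sqrt hb.le).symm⟩
  rw [Real.sqrt_sq hx.le, Real.sqrt_sq hz.le, ← div_pow, Real.log_pow]
  have h := Real.one_sub_inv_le_log_of_pos (div_pos hx hz)
  rw [inv_div] at h
  calc (x - z) ^ 2 + (x ^ 2 - z ^ 2) = x ^ 2 * (2 * (1 - z / x)) := by field_simp; ring
    _ ≤ x ^ 2 * ((2 : ℕ) * Real.log (x / z)) := by push_cast; gcongr

lemma hellingerSq_le_KL (hp : IsPmf p) (hq : IsPmf q) :
    (hellingerSq p q : EReal) ≤ KL p q := by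
  unfold KL
  split_ifs with h
  · rw [EReal.coe_le_coe_iff]
    calc hellingerSq p q = ∑ y, ((√(p y) - √(q y)) ^ 2 + (p y - q y)) := by
          simp [hellingerSq, Finset.sum_add_distrib, hp.2, hq.2]
      _ ≤ _ := Finset.sum_le_sum fun y _ =>
          sq_sqrt_sub_sqrt_add_sub_le_mul_log (hp.1 y) (hq.1 y) (h y)
  · exact le_top

lemma KL_nonneg (hp : IsPmf p) (hq : IsPmf q) : 0 ≤ KL p q :=
  (EReal.coe_nonneg.2 (hellingerSq_nonneg p q)).trans (hellingerSq_le_KL hp hq)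

lemma mul_log_le {a b c : ℝ} (ha : 0 ≤ a) (ha1 : a ≤ 1) (hc : 0 < c) (hcb : c ≤ b)
    (hb1 : b ≤ 1) : a * Real.log (a / b) ≤ 4 / c * (√a - √b) ^ 2 + (a - b) := by
  have hb : 0 < b := hc.trans_le hcb
  have h1 : a * Real.log (a / b) ≤ a * (a / b - 1) := by
    rcases ha.eq_or_lt with rfl | ha
    · simp
    · gcongr
      exact Real.log_le_sub_one_of_pos (div_pos ha hb)
  have h2 : a * (a / b - 1) = (a - b) ^ 2 / b + (a - b) := by field_simp; ring
  have h3 : (a - b) ^ 2 ≤ 4 * (√a - √b) ^ 2 := by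
    have : (√a + √b) ^ 2 ≤ 2 ^ 2 := by
      gcongr
      linarith [Real.sqrt_le_one.2 ha1, Real.sqrt_le_one.2 hb1]
    calc (a - b) ^ 2 = (√a + √b) ^ 2 * (√a - √b) ^ 2 := by
          rw [← mul_pow, ← sq_sub_sq, Real.sq_sqrt ha, Real.sq_sqrt hb.le]
      _ ≤ 2 ^ 2 * (√a - √b) ^ 2 := by gcongr
      _ = _ := by norm_num
  have h4 : (a - b) ^ 2 / b ≤ 4 * (√a - √b) ^ 2 / c := by gcongr
  rw [div_mul_eq_mul_div]
  linarith

lemma KL_le_hellingerSq {c : ℝ} (hp : IsPmf p) (hq : IsPmf q) (hc : 0 < c)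
    (hcq : ∀ y, c ≤ q y) : KL p q ≤ ((4 / c * hellingerSq p q : ℝ) : EReal) := by
  unfold KL
  rw [if_pos fun y hy => absurd hy (hc.trans_le (hcq y)).ne', EReal.coe_le_coe_iff]
  calc _ ≤ ∑ y, (4 / c * (√(p y) - √(q y)) ^ 2 + (p y - q y)) :=
        Finset.sum_le_sum fun y _ =>
          mul_log_le (hp.1 y) (hp.le_one y) hc (hcq y) (hq.le_one y)
    _ = _ := by simp [hellingerSq, Finset.sum_add_distrib, Finset.mul_sum, hp.2, hq.2]

lemma div_four_le_of_hellingerSq_le {m : ℝ} (hm : 0 < m) (hmq : ∀ y, m ≤ q y)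
    (hp : ∀ y, 0 ≤ p y) (h : hellingerSq p q ≤ m / 4) (y : Y) : m / 4 ≤ p y := by
  have h1 := (sq_sqrt_sub_sqrt_le_hellingerSq p q y).trans h
  have h2 : √m ≤ √(q y) := Real.sqrt_le_sqrt (hmq y)
  have h3 : m / 4 = (√m / 2) ^ 2 := by rw [div_pow, Real.sq_sqrt hm.le]; norm_num
  rw [h3] at h1 ⊢
  have h4 := abs_le_of_sq_le_sq' h1 (by positivity)
  rw [← Real.sq_sqrt (hp y)]
  gcongr
  linarith [h4.1]

/-- If `μ` is at squared Hellinger distance at least `δ` from `π`, then the objective of the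
exponent is bounded below by a positive constant depending only on `δ` and `π`. -/
lemma exists_pos_le_KL_add_KL_add_KL [Nonempty Y] {π : Y → ℝ} (hπ : IsPmf π)
    (hπf : ∀ y, 0 < π y) {δ : ℝ} (hδ : 0 < δ) :
    ∃ ε : ℝ, 0 < ε ∧ ∀ μ q1 q2 q3 : Y → ℝ, IsPmf μ → IsPmf q1 → IsPmf q2 → IsPmf q3 →
      δ ≤ hellingerSq μ π → KL q1 q2 ≤ KL q3 q2 →
      (ε : EReal) ≤ KL q1 μ + KL q2 π + KL q3 π := by
  obtain ⟨y₀, hy₀⟩ := Finite.exists_min π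
  set m := π y₀
  have hm : 0 < m := hπf y₀
  have hK : 0 < 6 + 256 / m := by positivity
  refine ⟨min (m / 4) (δ / (6 + 256 / m)), by positivity, ?_⟩
  intro μ q1 q2 q3 hμ h1 h2 h3 hδμ hle
  by_contra! hlt
  set ε := min (m / 4) (δ / (6 + 256 / m))
  have k1 := KL_nonneg h1 hμ
  have k2 := KL_nonneg h2 hπ
  have k3 := KL_nonneg h3 hπ
  have d1 : hellingerSq q1 μ < ε := EReal.coe_lt_coe_iff.1 <|
    ((hellingerSq_le_KL h1 hμ).trans
      ((le_add_of_nonneg_right k2).trans (le_add_of_nonneg_right k3))).trans_lt hlt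
  have d2 : hellingerSq q2 π < ε := EReal.coe_lt_coe_iff.1 <|
    ((hellingerSq_le_KL h2 hπ).trans
      ((le_add_of_nonneg_left k1).trans (le_add_of_nonneg_right k3))).trans_lt hlt
  have d3 : hellingerSq q3 π < ε := EReal.coe_lt_coe_iff.1 <|
    ((hellingerSq_le_KL h3 hπ).trans (le_add_of_nonneg_left (add_nonneg k1 k2))).trans_lt hlt
  have hq2 := div_four_le_of_hellingerSq_le hm hy₀ h2.1 (d2.le.trans (min_le_left _ _))
  have d12 : hellingerSq q1 q2 ≤ 4 / (m / 4) * hellingerSq q3 q2 := EReal.coe_le_coe_iff.1 <|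
    (hellingerSq_le_KL h1 h2).trans (hle.trans (KL_le_hellingerSq h3 h2 (by positivity) hq2))
  have d32 : hellingerSq q3 q2 ≤ 4 * ε := by
    have := hellingerSq_triangle q3 π q2
    rw [hellingerSq_comm π q2] at this
    linarith
  have d12' : hellingerSq q1 q2 ≤ 64 / m * ε := by
    calc _ ≤ _ := d12
      _ ≤ 4 / (m / 4) * (4 * ε) := by gcongr
      _ = _ := by field_simp; ring
  have t1 := hellingerSq_triangle μ q1 π
  have t2 := hellingerSq_triangle q1 q2 π
  rw [hellingerSq_comm μ q1] at t1
  have hε : ε * (6 + 256 / m) ≤ δ := (le_div_iff₀ hK).1 (min_le_right _ _)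
  have e : ε * (6 + 256 / m) = 6 * ε + 4 * (64 / m * ε) := by ring
  linarith

end

/-- positivity of the exponent `α1`. For a full-support pmf `π`
and full-support pmfs `μ i ≠ π` (`i ∈ S`, `S` nonempty finite), the infimum over
`i ∈ S` and pmf triples `(q1,q2,q3)` with `D(q1‖q2) ≤ D(q3‖q2)` of
`D(q1‖μ i) + D(q2‖π) + D(q3‖π)` is strictly positive. -/
theorem alpha1_pos {Y : Type*} [Fintype Y] [Nonempty Y] {ι : Type*}
    (S : Finset ι) (hS : S.Nonempty)
    (π : Y → ℝ) (hπ : IsPmf π) (hπf : ∀ y, 0 < π y)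
    (μ : ι → Y → ℝ) (hμ : ∀ i ∈ S, IsPmf (μ i)) (hμf : ∀ i ∈ S, ∀ y, 0 < μ i y)
    (hne : ∀ i ∈ S, μ i ≠ π) :
    0 < sInf {r : EReal | ∃ i ∈ S, ∃ q1 q2 q3 : Y → ℝ,
      IsPmf q1 ∧ IsPmf q2 ∧ IsPmf q3 ∧
      KL q1 q2 ≤ KL q3 q2 ∧
      r = KL q1 (μ i) + KL q2 π + KL q3 π} := by
  obtain ⟨i₀, hi₀, hmin⟩ := S.exists_min_image (fun i => hellingerSq (μ i) π) hS
  obtain ⟨ε, hε, h⟩ := exists_pos_le_KL_add_KL_add_KL hπ hπf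
    (hellingerSq_pos (hμ i₀ hi₀).1 hπ.1 (hne i₀ hi₀))
  refine (EReal.coe_pos.2 hε).trans_le (le_sInf ?_)
  rintro _ ⟨i, hi, q1, q2, q3, h1, h2, h3, hle, rfl⟩
  exact h (μ i) q1 q2 q3 (hμ i hi) h1 h2 h3 (hmin i hi) hle
end

section
/- (Upper bound on the exponent α1 via the Bhattacharyya distance) Let Y be a finite alphabet, let S be a nonempty finite index set, and let π and μ_i (i ∈ S) be pmfs on Y with full support such that μ_i ≠ π for every i ∈ S. Then the infimum, over i ∈ S and over triples of pmfs (q1, q2, q3) on Y satisfying D(q1‖q2) ≤ D(q3‖q2), of D(q1‖μ_i) + D(q2‖π) + D(q3‖π), is strictly less than min_{i∈S} 2·B(μ_i, π). -/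
open scoped BigOperators

/-- The real-valued KL divergence sum. -/
noncomputable def klSum {Y : Type*} [Fintype Y] (p q : Y → ℝ) : ℝ :=
  ∑ y, p y * Real.log (p y / q y)

lemma KL_eq_klSum {Y : Type*} [Fintype Y] {p q : Y → ℝ} (hq : ∀ y, 0 < q y) :
    KL p q = (klSum p q : EReal) :=
  if_pos fun y h => absurd h (hq y).ne'

lemma klSum_self {Y : Type*} [Fintype Y] (p : Y → ℝ) : klSum p p = 0 := by
  refine Finset.sum_eq_zero fun y _ => ?_
  by_cases h : p y = 0 <;> simp [h]

/-- Strict Gibbs inequality for full-support pmfs. -/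
lemma klSum_pos {Y : Type*} [Fintype Y] {p q : Y → ℝ} (hp : ∀ y, 0 < p y)
    (hq : ∀ y, 0 < q y) (hp1 : ∑ y, p y = 1) (hq1 : ∑ y, q y = 1) (hne : p ≠ q) :
    0 < klSum p q := by
  have hlog : ∀ y, p y * Real.log (p y / q y) = -(p y * Real.log (q y / p y)) := by
    intro y
    rw [← inv_div, Real.log_inv, mul_neg]
  have hmul : ∀ y, p y * (q y / p y - 1) = q y - p y := by
    intro y
    have := (hp y).ne'
    field_simp
  have hlt : ∑ y, (p y - q y) < klSum p q := by
    refine Finset.sum_lt_sum (fun y _ => ?_) ?_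
    · have := mul_le_mul_of_nonneg_left
        (Real.log_le_sub_one_of_pos (div_pos (hq y) (hp y))) (hp y).le
      linarith [hlog y, hmul y]
    · obtain ⟨y, hy⟩ := Function.ne_iff.mp hne
      refine ⟨y, Finset.mem_univ y, ?_⟩
      have h1 : q y / p y ≠ 1 := fun h => hy ((div_eq_one_iff_eq (hp y).ne').mp h).symm
      have := mul_lt_mul_of_pos_left
        (Real.log_lt_sub_one_of_pos (div_pos (hq y) (hp y)) h1) (hp y)
      linarith [hlog y, hmul y]
  rwa [Finset.sum_sub_distrib, hp1, hq1, sub_self] at hlt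

/-- Convexity of the KL divergence in its first argument. -/
lemma klSum_mix_le {Y : Type*} [Fintype Y] {a b r : Y → ℝ} (ha : ∀ y, 0 ≤ a y)
    (hb : ∀ y, 0 ≤ b y) (hr : ∀ y, 0 < r y) {t : ℝ} (ht0 : 0 ≤ t) (ht1 : t ≤ 1) :
    klSum (fun y => (1 - t) * a y + t * b y) r ≤ (1 - t) * klSum a r + t * klSum b r := by
  have key : ∀ x y, x * Real.log (x / r y) = x * Real.log x - x * Real.log (r y) := by
    intro x y
    rcases eq_or_ne x 0 with rfl | hx
    · simp
    · rw [Real.log_div hx (hr y).ne', mul_sub]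
  simp only [klSum]
  rw [Finset.mul_sum, Finset.mul_sum, ← Finset.sum_add_distrib]
  refine Finset.sum_le_sum fun y _ => ?_
  have h := Real.convexOn_mul_log.2 (Set.mem_Ici.2 (ha y)) (Set.mem_Ici.2 (hb y))
    (sub_nonneg.2 ht1) ht0 (by ring)
  simp only [smul_eq_mul] at h
  rw [key, key, key]
  linarith

/-- The normalized geometric mean of two pmfs attains twice the Bhattacharyya distance and
differs from both pmfs. -/
lemma exists_geometric_mean {Y : Type*} [Fintype Y] [Nonempty Y] {m p : Y → ℝ}
    (hm : ∀ y, 0 < m y) (hp : ∀ y, 0 < p y) (hm1 : ∑ y, m y = 1) (hp1 : ∑ y, p y = 1)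
    (hne : m ≠ p) :
    ∃ q : Y → ℝ, (∀ y, 0 < q y) ∧ ∑ y, q y = 1 ∧ q ≠ m ∧ q ≠ p ∧
      klSum q m + klSum q p = 2 * Bhat m p := by
  set Z : ℝ := ∑ y, √(m y) * √(p y) with hZ
  have hg : ∀ y, 0 < √(m y) * √(p y) := fun y =>
    mul_pos (Real.sqrt_pos.2 (hm y)) (Real.sqrt_pos.2 (hp y))
  have hZpos : 0 < Z := Finset.sum_pos (fun y _ => hg y) Finset.univ_nonempty
  have hq : ∀ y, 0 < √(m y) * √(p y) / Z := fun y => div_pos (hg y) hZpos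
  have hq1 : ∑ y, √(m y) * √(p y) / Z = 1 := by
    rw [← Finset.sum_div, ← hZ, div_self hZpos.ne']
  have hsq : ∀ y, (√(m y) * √(p y) / Z) ^ 2 * Z ^ 2 = m y * p y := by
    intro y
    rw [div_pow, mul_pow, Real.sq_sqrt (hm y).le, Real.sq_sqrt (hp y).le,
      div_mul_cancel₀ _ (pow_pos hZpos 2).ne']
  refine ⟨fun y => √(m y) * √(p y) / Z, hq, hq1, fun h => hne ?_, fun h => hne ?_, ?_⟩
  · have h1 : ∀ y, m y * Z ^ 2 = p y := by
      intro y
      have := hsq y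
      rw [congrFun h y] at this
      exact mul_left_cancel₀ (hm y).ne' (by linarith)
    have h2 : Z ^ 2 = 1 := by
      rw [← hp1, ← Finset.sum_congr rfl fun y _ => h1 y, ← Finset.sum_mul, hm1, one_mul]
    funext y
    rw [← h1 y, h2, mul_one]
  · have h1 : ∀ y, p y * Z ^ 2 = m y := by
      intro y
      have := hsq y
      rw [congrFun h y] at this
      exact mul_left_cancel₀ (hp y).ne' (by linarith)
    have h2 : Z ^ 2 = 1 := by
      rw [← hm1, ← Finset.sum_congr rfl fun y _ => h1 y, ← Finset.sum_mul, hp1, one_mul]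
    funext y
    rw [← h1 y, h2, mul_one]
  · have hB : 2 * Bhat m p = ∑ y, √(m y) * √(p y) / Z * (-2 * Real.log Z) := by
      rw [← Finset.sum_mul, hq1, Bhat, ← hZ]
      ring
    rw [hB, klSum, klSum, ← Finset.sum_add_distrib]
    refine Finset.sum_congr rfl fun y _ => ?_
    have h := congrArg Real.log (hsq y)
    rw [Real.log_mul (pow_pos (hq y) 2).ne' (pow_pos hZpos 2).ne', Real.log_pow, Real.log_pow,
      Real.log_mul (hm y).ne' (hp y).ne'] at h
    push_cast at h
    rw [← mul_add, Real.log_div (hq y).ne' (hm y).ne', Real.log_div (hq y).ne' (hp y).ne']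
    congr 1
    linarith

/-- upper bound on the exponent `α1`. Under the same assumptions
as for `α1`, the infimum over `i ∈ S` and pmf triples `(q1,q2,q3)` with
`D(q1‖q2) ≤ D(q3‖q2)` of `D(q1‖μ i) + D(q2‖π) + D(q3‖π)` is strictly less than
`min_{i∈S} 2 B(μ i, π)`. -/
theorem alpha1_lt_twoBhat {Y : Type*} [Fintype Y] [Nonempty Y] {ι : Type*}
    (S : Finset ι) (hS : S.Nonempty)
    (π : Y → ℝ) (hπ : IsPmf π) (hπf : ∀ y, 0 < π y)
    (μ : ι → Y → ℝ) (hμ : ∀ i ∈ S, IsPmf (μ i)) (hμf : ∀ i ∈ S, ∀ y, 0 < μ i y)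
    (hne : ∀ i ∈ S, μ i ≠ π) :
    sInf {r : EReal | ∃ i ∈ S, ∃ q1 q2 q3 : Y → ℝ,
      IsPmf q1 ∧ IsPmf q2 ∧ IsPmf q3 ∧
      KL q1 q2 ≤ KL q3 q2 ∧
      r = KL q1 (μ i) + KL q2 π + KL q3 π}
    < (((S.inf' hS fun i => 2 * Bhat (μ i) π) : ℝ) : EReal) := by
  obtain ⟨i, hi, hmin⟩ := S.exists_mem_eq_inf' hS fun i => 2 * Bhat (μ i) π
  rw [hmin]
  have hm := hμf i hi
  obtain ⟨q, hq, hq1, hqm, hqp, hval⟩ :=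
    exists_geometric_mean hm hπf (hμ i hi).2 hπ.2 (hne i hi)
  have hc := klSum_pos hπf hq hπ.2 hq1 hqp.symm
  have hK := klSum_pos hm hq (hμ i hi).2 hq1 hqm.symm
  have hD := klSum_pos hq hm hq1 (hμ i hi).2 hqm
  have hcK := add_pos hc hK
  set t : ℝ := klSum π q / (klSum π q + klSum (μ i) q) with ht
  have ht0 : 0 < t := div_pos hc hcK
  have ht1 : t ≤ 1 := (div_le_one hcK).2 (by linarith)
  have htK : t * klSum (μ i) q ≤ klSum π q := by
    rw [ht, div_mul_eq_mul_div, div_le_iff₀ hcK]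
    nlinarith [sq_nonneg (klSum π q)]
  have hmixq := klSum_mix_le (fun y => (hq y).le) (fun y => (hm y).le) hq ht0.le ht1
  have hmixm := klSum_mix_le (fun y => (hq y).le) (fun y => (hm y).le) hm ht0.le ht1
  rw [klSum_self] at hmixq hmixm
  refine lt_of_le_of_lt (sInf_le ⟨i, hi, fun y => (1 - t) * q y + t * μ i y, q, π, ⟨fun y => ?_, ?_⟩,
    ⟨fun y => (hq y).le, hq1⟩, hπ, ?_, rfl⟩) ?_
  · exact add_nonneg (mul_nonneg (sub_nonneg.2 ht1) (hq y).le) (mul_nonneg ht0.le (hm y).le)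
  · rw [Finset.sum_add_distrib, ← Finset.mul_sum, ← Finset.mul_sum, hq1, (hμ i hi).2]
    ring
  · rw [KL_eq_klSum hq, KL_eq_klSum hq, EReal.coe_le_coe_iff]
    linarith
  · rw [KL_eq_klSum hm, KL_eq_klSum hπf, KL_eq_klSum hπf, klSum_self, ← EReal.coe_add,
      ← EReal.coe_add, EReal.coe_lt_coe_iff]
    nlinarith [mul_pos ht0 hD]
end

section
/- Let Y be a finite alphabet, let S be a nonempty finite index set, and let π and μ_i (i ∈ S) be pmfs on Y with full support such that μ_i ≠ π for every i ∈ S. Restricting the constraint set of the exponent α1 by requiring q1 = q3 yields exactly twice the minimal Bhattacharyya distance: the infimum, over i ∈ S and pairs of pmfs (q, q2) on Y, of D(q‖μ_i) + D(q2‖π) + D(q‖π) equals min_{i∈S} 2·B(μ_i, π). -/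
open scoped BigOperators

/-- On a fully supported reference measure, `KL` is given by its finite sum. -/
theorem KL_of_pos {Y : Type*} [Fintype Y] (p : Y → ℝ) {q : Y → ℝ} (hq : ∀ y, 0 < q y) :
    KL p q = ((∑ y, p y * Real.log (p y / q y) : ℝ) : EReal) :=
  if_pos fun y hy => absurd hy (hq y).ne'

theorem sub_le_mul_log_div {a b : ℝ} (ha : 0 ≤ a) (hb : 0 < b) :
    a - b ≤ a * Real.log (a / b) := by
  rcases ha.eq_or_lt with rfl | ha
  · simpa using hb.le
  · have h := Real.one_sub_inv_le_log_of_pos (div_pos ha hb)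
    calc a - b = a * (1 - (a / b)⁻¹) := by field_simp
      _ ≤ a * Real.log (a / b) := by gcongr

/-- Gibbs' inequality. -/
theorem sum_mul_log_div_nonneg {Y : Type*} [Fintype Y] {p q : Y → ℝ} (hp : IsPmf p)
    (hq : IsPmf q) (hqf : ∀ y, 0 < q y) : 0 ≤ ∑ y, p y * Real.log (p y / q y) :=
  calc (0 : ℝ) = ∑ y, (p y - q y) := by rw [Finset.sum_sub_distrib, hp.2, hq.2, sub_self]
    _ ≤ _ := Finset.sum_le_sum fun y _ => sub_le_mul_log_div (hp.1 y) (hqf y)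

/-- The normalized geometric mean of two weight functions. -/
noncomputable def geomMean {Y : Type*} [Fintype Y] (p q : Y → ℝ) (y : Y) : ℝ :=
  Real.sqrt (p y) * Real.sqrt (q y) / ∑ z, Real.sqrt (p z) * Real.sqrt (q z)

section

variable {Y : Type*} [Fintype Y] [Nonempty Y] {p q : Y → ℝ}

theorem sum_sqrt_mul_sqrt_pos (hp : ∀ y, 0 < p y) (hq : ∀ y, 0 < q y) :
    0 < ∑ y, Real.sqrt (p y) * Real.sqrt (q y) :=
  Finset.sum_pos (fun y _ => mul_pos (Real.sqrt_pos.2 (hp y)) (Real.sqrt_pos.2 (hq y)))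
    Finset.univ_nonempty

theorem geomMean_pos (hp : ∀ y, 0 < p y) (hq : ∀ y, 0 < q y) (y : Y) : 0 < geomMean p q y :=
  div_pos (mul_pos (Real.sqrt_pos.2 (hp y)) (Real.sqrt_pos.2 (hq y)))
    (sum_sqrt_mul_sqrt_pos hp hq)

theorem isPmf_geomMean (hp : ∀ y, 0 < p y) (hq : ∀ y, 0 < q y) : IsPmf (geomMean p q) := by
  refine ⟨fun y => (geomMean_pos hp hq y).le, ?_⟩
  simp only [geomMean]
  rw [← Finset.sum_div, div_self (sum_sqrt_mul_sqrt_pos hp hq).ne']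

/-- The sum of the divergences of `r` from `p` and `q` is `2 B(p, q)` plus twice the divergence
of `r` from the normalized geometric mean of `p` and `q`. -/
theorem sum_mul_log_div_add_sum_mul_log_div (hp : ∀ y, 0 < p y) (hq : ∀ y, 0 < q y)
    {r : Y → ℝ} (hr : IsPmf r) :
    ∑ y, r y * Real.log (r y / p y) + ∑ y, r y * Real.log (r y / q y)
      = 2 * Bhat p q + 2 * ∑ y, r y * Real.log (r y / geomMean p q y) := by
  have hZ := sum_sqrt_mul_sqrt_pos hp hq
  have hB : 2 * Bhat p q = ∑ y, r y * (2 * Bhat p q) := by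
    rw [← Finset.sum_mul, hr.2, one_mul]
  rw [hB, Finset.mul_sum, ← Finset.sum_add_distrib, ← Finset.sum_add_distrib]
  refine Finset.sum_congr rfl fun y _ => ?_
  rcases (hr.1 y).eq_or_lt with h | h
  · simp [← h]
  · have hsp := Real.sqrt_pos.2 (hp y)
    have hsq := Real.sqrt_pos.2 (hq y)
    rw [Real.log_div h.ne' (hp y).ne', Real.log_div h.ne' (hq y).ne',
      Real.log_div h.ne' (geomMean_pos hp hq y).ne', geomMean,
      Real.log_div (mul_pos hsp hsq).ne' hZ.ne', Real.log_mul hsp.ne' hsq.ne',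
      Real.log_sqrt (hp y).le, Real.log_sqrt (hq y).le, Bhat]
    ring

end

/-- Restricting the constraint set of `α1` by requiring
`q1 = q3 = q` yields exactly twice the minimal Bhattacharyya distance: the
infimum over `i ∈ S` and pmf pairs `(q, q2)` of `D(q‖μ i) + D(q2‖π) + D(q‖π)`
equals `min_{i∈S} 2 B(μ i, π)`. -/
theorem restricted_inf_eq_twoBhat {Y : Type*} [Fintype Y] [Nonempty Y] {ι : Type*}
    (S : Finset ι) (hS : S.Nonempty)
    (π : Y → ℝ) (hπ : IsPmf π) (hπf : ∀ y, 0 < π y)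
    (μ : ι → Y → ℝ) (hμ : ∀ i ∈ S, IsPmf (μ i)) (hμf : ∀ i ∈ S, ∀ y, 0 < μ i y)
    (hne : ∀ i ∈ S, μ i ≠ π) :
    sInf {r : EReal | ∃ i ∈ S, ∃ q q2 : Y → ℝ,
      IsPmf q ∧ IsPmf q2 ∧
      r = KL q (μ i) + KL q2 π + KL q π}
    = (((S.inf' hS fun i => 2 * Bhat (μ i) π) : ℝ) : EReal) := by
  apply le_antisymm
  · obtain ⟨i, hi, h⟩ := S.exists_mem_eq_inf' hS fun i => 2 * Bhat (μ i) π
    rw [h]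
    have hg := isPmf_geomMean (hμf i hi) hπf
    refine sInf_le ⟨i, hi, geomMean (μ i) π, π, hg, hπ, ?_⟩
    rw [KL_of_pos _ (hμf i hi), KL_of_pos _ hπf, KL_of_pos _ hπf,
      ← EReal.coe_add, ← EReal.coe_add, EReal.coe_eq_coe_iff]
    have hsum := sum_mul_log_div_add_sum_mul_log_div (hμf i hi) hπf hg
    have hππ : ∑ y, π y * Real.log (π y / π y) = 0 :=
      Finset.sum_eq_zero fun y _ => by rw [div_self (hπf y).ne', Real.log_one, mul_zero]
    have hgg : ∑ y, geomMean (μ i) π y * Real.log (geomMean (μ i) π y / geomMean (μ i) π y) = 0 :=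
      Finset.sum_eq_zero fun y _ => by
        rw [div_self (geomMean_pos (hμf i hi) hπf y).ne', Real.log_one, mul_zero]
    linarith
  · refine le_sInf ?_
    rintro _ ⟨i, hi, q, q2, hq, hq2, rfl⟩
    rw [KL_of_pos _ (hμf i hi), KL_of_pos _ hπf, KL_of_pos _ hπf,
      ← EReal.coe_add, ← EReal.coe_add, EReal.coe_le_coe_iff]
    refine (Finset.inf'_le _ hi).trans ?_
    have hsum := sum_mul_log_div_add_sum_mul_log_div (hμf i hi) hπf hq
    have hq_nonneg := sum_mul_log_div_nonneg hq (isPmf_geomMean (hμf i hi) hπf)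
      (geomMean_pos (hμf i hi) hπf)
    have hq2_nonneg := sum_mul_log_div_nonneg hq2 hπ hπf
    linarith
end

section
/- (Positivity of the exponent α7 under the clustering condition) Let Y be a finite alphabet, let S and T be nonempty finite index sets, and let μ_i (i ∈ S) and π_j (j ∈ T) be pmfs on Y with full support satisfying the clustering condition: max_{i,i'∈S} D(μ_i‖μ_{i'}) < min_{i∈S, j∈T} min{ D(μ_i‖π_j), D(π_j‖μ_i) } and max_{j,j'∈T} D(π_j‖π_{j'}) < min_{i∈S, j∈T} min{ D(μ_i‖π_j), D(π_j‖μ_i) }. Then the infimum, over j1, j2 ∈ T, i ∈ S, and triples of pmfs (q1, q2, q3) on Y satisfying D(q1‖q2) > D(q3‖q2), of D(q1‖π_{j1}) + D(q2‖π_{j2}) + D(q3‖μ_i), is strictly positive. -/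
open scoped BigOperators

open Filter Topology InformationTheory

/-- The real-valued expression for the KL divergence, without the support condition. -/
noncomputable def klReal {Y : Type*} [Fintype Y] (p q : Y → ℝ) : ℝ :=
  ∑ y, p y * Real.log (p y / q y)

lemma KL_eq_klReal {Y : Type*} [Fintype Y] (p : Y → ℝ) {q : Y → ℝ} (hq : ∀ y, 0 < q y) :
    KL p q = (klReal p q : EReal) :=
  if_pos fun y hy => absurd hy (hq y).ne'

lemma klReal_eq_sum_mul_klFun {Y : Type*} [Fintype Y] {p q : Y → ℝ} (hp : IsPmf p)
    (hq : IsPmf q) (hqf : ∀ y, 0 < q y) :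
    klReal p q = ∑ y, q y * klFun (p y / q y) := by
  have h : ∀ y, q y * klFun (p y / q y) = p y * Real.log (p y / q y) + (q y - p y) := fun y => by
    have := (hqf y).ne'
    simp only [klFun]
    field_simp
    ring
  simp_rw [h, Finset.sum_add_distrib, Finset.sum_sub_distrib, hp.2, hq.2, klReal]
  ring

lemma klReal_nonneg {Y : Type*} [Fintype Y] {p q : Y → ℝ} (hp : IsPmf p)
    (hq : IsPmf q) (hqf : ∀ y, 0 < q y) : 0 ≤ klReal p q := by
  rw [klReal_eq_sum_mul_klFun hp hq hqf]
  exact Finset.sum_nonneg fun y _ =>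
    mul_nonneg (hq.1 y) (klFun_nonneg (div_nonneg (hp.1 y) (hq.1 y)))

lemma eq_of_klReal_eq_zero {Y : Type*} [Fintype Y] {p q : Y → ℝ} (hp : IsPmf p)
    (hq : IsPmf q) (hqf : ∀ y, 0 < q y) (h : klReal p q = 0) : p = q := by
  rw [klReal_eq_sum_mul_klFun hp hq hqf, Finset.sum_eq_zero_iff_of_nonneg fun y _ =>
    mul_nonneg (hq.1 y) (klFun_nonneg (div_nonneg (hp.1 y) (hq.1 y)))] at h
  ext y
  have h1 := (mul_eq_zero.1 (h y (Finset.mem_univ y))).resolve_left (hqf y).ne'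
  rw [klFun_eq_zero_iff (div_nonneg (hp.1 y) (hq.1 y))] at h1
  exact (div_eq_one_iff_eq (hqf y).ne').1 h1

lemma ContinuousAt.klReal {X Y : Type*} [TopologicalSpace X] [Fintype Y] {f g : X → Y → ℝ} {x : X}
    (hf : ContinuousAt f x) (hg : ContinuousAt g x) (hx : ∀ y, 0 < g x y) :
    ContinuousAt (fun z => klReal (f z) (g z)) x := by
  have hg' : ∀ y, ∀ᶠ z in 𝓝 x, 0 < g z y := fun y =>
    (continuousAt_pi.1 hg y).eventually_const_lt (hx y)
  refine tendsto_finsetSum _ fun y _ => ?_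
  have hfy := continuousAt_pi.1 hf y
  have hgy := continuousAt_pi.1 hg y
  have hd : ContinuousAt (fun z => f z y / g z y) x := hfy.div hgy (hx y).ne'
  have key : ContinuousAt (fun z => g z y * (f z y / g z y * Real.log (f z y / g z y))) x :=
    hgy.mul (Real.continuous_mul_log.continuousAt.comp hd)
  refine ContinuousAt.congr key ((hg' y).mono fun z hz => ?_)
  have := hz.ne'
  field_simp

/-- If `D(a‖b) < D(c‖b)`, then triples of pmfs with `D(q1‖q2) > D(q3‖q2)` stay at a positive total
divergence from `(a, b, c)`. -/
lemma exists_pos_le_klReal_add {Y : Type*} [Fintype Y] {a b c : Y → ℝ}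
    (ha : IsPmf a) (haf : ∀ y, 0 < a y) (hb : IsPmf b) (hbf : ∀ y, 0 < b y)
    (hc : IsPmf c) (hcf : ∀ y, 0 < c y) (h : klReal a b < klReal c b) :
    ∃ ε > 0, ∀ q1 q2 q3 : Y → ℝ, IsPmf q1 → IsPmf q2 → IsPmf q3 → KL q3 q2 < KL q1 q2 →
      ε ≤ klReal q1 a + klReal q2 b + klReal q3 c := by
  let U : Set ((Y → ℝ) × (Y → ℝ) × (Y → ℝ)) :=
    {q | (∀ y, 0 < q.2.1 y) ∧ klReal q.1 q.2.1 < klReal q.2.2 q.2.1}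
  let F : (Y → ℝ) × (Y → ℝ) × (Y → ℝ) → ℝ := fun q =>
    klReal q.1 a + klReal q.2.1 b + klReal q.2.2 c
  have hU : (a, b, c) ∈ interior U := by
    rw [mem_interior_iff_mem_nhds]
    have h1 : ∀ᶠ q : (Y → ℝ) × (Y → ℝ) × (Y → ℝ) in 𝓝 (a, b, c), ∀ y, 0 < q.2.1 y :=
      eventually_all.2 fun y => continuousAt_const.eventually_lt
        (g := fun q : (Y → ℝ) × (Y → ℝ) × (Y → ℝ) => q.2.1 y) (by fun_prop) (hbf y)
    have h2 : ∀ᶠ q : (Y → ℝ) × (Y → ℝ) × (Y → ℝ) in 𝓝 (a, b, c),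
        klReal q.1 q.2.1 < klReal q.2.2 q.2.1 :=
      ContinuousAt.eventually_lt
        (ContinuousAt.klReal (by fun_prop) (by fun_prop) hbf)
        (ContinuousAt.klReal (by fun_prop) (by fun_prop) hbf) h
    exact h1.and h2
  have hF : Continuous F := continuous_iff_continuousAt.2 fun q =>
    ((ContinuousAt.klReal (by fun_prop) continuousAt_const haf).add
      (ContinuousAt.klReal (by fun_prop) continuousAt_const hbf)).add
      (ContinuousAt.klReal (by fun_prop) continuousAt_const hcf)
  let K := (stdSimplex ℝ Y ×ˢ stdSimplex ℝ Y ×ˢ stdSimplex ℝ Y) \ interior U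
  have hK : IsCompact K := ((isCompact_stdSimplex ℝ Y).prod
    ((isCompact_stdSimplex ℝ Y).prod (isCompact_stdSimplex ℝ Y))).diff isOpen_interior
  have hpos : ∀ q ∈ K, 0 < F q := by
    rintro ⟨q1, q2, q3⟩ ⟨⟨h1, h2, h3⟩, hn⟩
    change IsPmf q1 at h1
    change IsPmf q2 at h2
    change IsPmf q3 at h3
    have n1 := klReal_nonneg h1 ha haf
    have n2 := klReal_nonneg h2 hb hbf
    have n3 := klReal_nonneg h3 hc hcf
    refine lt_of_le_of_ne (add_nonneg (add_nonneg n1 n2) n3) fun h0 => hn ?_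
    simp only [F] at h0
    rw [eq_of_klReal_eq_zero h1 ha haf (by linarith), eq_of_klReal_eq_zero h2 hb hbf (by linarith),
      eq_of_klReal_eq_zero h3 hc hcf (by linarith)]
    exact hU
  obtain ⟨ε, hε, hle⟩ : ∃ ε > 0, ∀ q ∈ K, ε ≤ F q := by
    rcases K.eq_empty_or_nonempty with h0 | hne
    · exact ⟨1, one_pos, by simp [h0]⟩
    · obtain ⟨q, hq, hmin⟩ := hK.exists_isMinOn hne hF.continuousOn
      exact ⟨F q, hpos q hq, fun r hr => hmin hr⟩
  refine ⟨ε, hε, fun q1 q2 q3 h1 h2 h3 hlt => hle (q1, q2, q3) ⟨⟨h1, h2, h3⟩, fun hm => ?_⟩⟩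
  obtain ⟨hf, hl⟩ := interior_subset hm
  rw [KL_eq_klReal _ hf, KL_eq_klReal _ hf, EReal.coe_lt_coe_iff] at hlt
  exact lt_asymm hlt hl

/-- positivity of the exponent α7 under the clustering
condition. The clustering condition states that the KL divergence between any
two distributions within the same cluster (outlying cluster `{μ i}_{i∈S}` or
typical cluster `{π j}_{j∈T}`) is strictly less than the KL divergence, in
either direction, between any two distributions in different clusters. Under it,
the stated infimum is strictly positive. -/
theorem alpha7_pos {Y : Type*} [Fintype Y] [Nonempty Y] {ι κ : Type*}
    (S : Finset ι) (hS : S.Nonempty) (T : Finset κ) (hT : T.Nonempty)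
    (μ : ι → Y → ℝ) (π : κ → Y → ℝ)
    (hμ : ∀ i ∈ S, IsPmf (μ i)) (hμf : ∀ i ∈ S, ∀ y, 0 < μ i y)
    (hπ : ∀ j ∈ T, IsPmf (π j)) (hπf : ∀ j ∈ T, ∀ y, 0 < π j y)
    (hclusterμ : ∀ i ∈ S, ∀ i' ∈ S, ∀ i'' ∈ S, ∀ j ∈ T,
      KL (μ i) (μ i') < KL (μ i'') (π j) ∧ KL (μ i) (μ i') < KL (π j) (μ i''))
    (hclusterπ : ∀ j ∈ T, ∀ j' ∈ T, ∀ i ∈ S, ∀ j'' ∈ T,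
      KL (π j) (π j') < KL (μ i) (π j'') ∧ KL (π j) (π j') < KL (π j'') (μ i)) :
    0 < sInf {r : EReal | ∃ j1 ∈ T, ∃ j2 ∈ T, ∃ i ∈ S, ∃ q1 q2 q3 : Y → ℝ,
      IsPmf q1 ∧ IsPmf q2 ∧ IsPmf q3 ∧
      KL q3 q2 < KL q1 q2 ∧
      r = KL q1 (π j1) + KL q2 (π j2) + KL q3 (μ i)} := by
  have key : ∀ᶠ ε : ℝ in 𝓝[>] 0, ∀ j1 ∈ T, ∀ j2 ∈ T, ∀ i ∈ S, ∀ q1 q2 q3 : Y → ℝ,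
      IsPmf q1 → IsPmf q2 → IsPmf q3 → KL q3 q2 < KL q1 q2 →
      ε ≤ klReal q1 (π j1) + klReal q2 (π j2) + klReal q3 (μ i) := by
    refine (eventually_all_finset T).2 fun j1 h1 => (eventually_all_finset T).2 fun j2 h2 =>
      (eventually_all_finset S).2 fun i hi => ?_
    have hlt := (hclusterπ j1 h1 j2 h2 i hi j2 h2).1
    rw [KL_eq_klReal _ (hπf j2 h2), KL_eq_klReal _ (hπf j2 h2), EReal.coe_lt_coe_iff] at hlt
    obtain ⟨ε, hε, hle⟩ := exists_pos_le_klReal_add (hπ j1 h1) (hπf j1 h1) (hπ j2 h2) (hπf j2 h2)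
      (hμ i hi) (hμf i hi) hlt
    filter_upwards [Ioo_mem_nhdsGT hε] with δ hδ q1 q2 q3 p1 p2 p3 hq
    exact hδ.2.le.trans (hle q1 q2 q3 p1 p2 p3 hq)
  obtain ⟨ε, hle, hε⟩ := (key.and self_mem_nhdsWithin).exists
  refine lt_of_lt_of_le (EReal.coe_pos.2 hε) (le_sInf ?_)
  rintro r ⟨j1, h1, j2, h2, i, hi, q1, q2, q3, p1, p2, p3, hq, rfl⟩
  rw [KL_eq_klReal _ (hπf j1 h1), KL_eq_klReal _ (hπf j2 h2), KL_eq_klReal _ (hμf i hi)]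
  exact_mod_cast hle j1 h1 j2 h2 i hi q1 q2 q3 p1 p2 p3 hq
end
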